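/- Let K = convexHull ℝ S be a convex polytope in E = EuclideanSpace ℝ (Fin 3) (S finite, interior K nonempty), and let γ be a simple closed geodesic in frontier K. Then the image of γ contains no extreme point of K; that is, Set.range γ ∩ Set.extremePoints ℝ K = ∅. -/

import Mathlib

/-- A simple closed geodesic in a closed set `F ⊆ EuclideanSpace ℝ (Fin 3)`:
a continuous map `γ : ℝ → E`, periodic with period 1, injective on `[0,1)`,
with image in `F`, of finite positive length (total variation on `[0,1]`),
that is locally shortest among continuous paths in `F`. -/
def IsSimpleClosedGeodesicIn (F : Set (EuclideanSpace ℝ (Fin 3)))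
    (γ : ℝ → EuclideanSpace ℝ (Fin 3)) : Prop :=
  Continuous γ ∧
  Function.Periodic γ 1 ∧
  Set.InjOn γ (Set.Ico (0 : ℝ) 1) ∧
  (∀ t : ℝ, γ t ∈ F) ∧
  0 < eVariationOn γ (Set.Icc 0 1) ∧
  eVariationOn γ (Set.Icc 0 1) < ⊤ ∧
  ∀ t : ℝ, ∃ ε > (0 : ℝ), ∀ s₁ s₂ : ℝ,
    s₁ ∈ Set.Ioo (t - ε) (t + ε) → s₂ ∈ Set.Ioo (t - ε) (t + ε) → s₁ ≤ s₂ →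
    ∀ (a b : ℝ) (c : ℝ → EuclideanSpace ℝ (Fin 3)), a ≤ b →
      ContinuousOn c (Set.Icc a b) → c a = γ s₁ → c b = γ s₂ →
      (∀ x ∈ Set.Icc a b, c x ∈ F) →
      eVariationOn γ (Set.Icc s₁ s₂) ≤ eVariationOn c (Set.Icc a b)

/-- A nonempty complete convex set in a real inner product space is a nonexpansive retract, by a
retraction that sends every point outside the interior to the boundary. -/
theorem exists_nonexpansive_retraction {V : Type*} [NormedAddCommGroup V] [InnerProductSpace ℝ V]
    {K : Set V} (hne : K.Nonempty) (hcomp : IsComplete K) (hconv : Convex ℝ K) :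
    ∃ r : V → V, LipschitzWith 1 r ∧ (∀ x ∈ K, r x = x) ∧
      ∀ x, x ∉ interior K → r x ∈ frontier K := by
  choose r hrK hr using fun x => exists_norm_eq_iInf_of_complete_convex hne hcomp hconv x
  have hvar : ∀ x, ∀ w ∈ K, inner ℝ (x - r x) (w - r x) ≤ 0 := fun x =>
    (norm_eq_iInf_iff_real_inner_le_zero hconv (hrK x)).1 (hr x)
  have hfix : ∀ x ∈ K, r x = x := by
    intro x hx
    have h := hvar x x hx
    rw [real_inner_self_eq_norm_sq] at h
    have : ‖x - r x‖ = 0 := by nlinarith [norm_nonneg (x - r x)]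
    exact (sub_eq_zero.1 (norm_eq_zero.1 this)).symm
  refine ⟨r, LipschitzWith.of_dist_le_mul fun x y => ?_, hfix, fun x hx => ?_⟩
  · rw [NNReal.coe_one, one_mul, dist_eq_norm, dist_eq_norm]
    have h1 := hvar x (r y) (hrK y)
    have h2 := hvar y (r x) (hrK x)
    have h3 := real_inner_le_norm (x - y) (r x - r y)
    have h4 : ‖r x - r y‖ ^ 2 ≤ inner ℝ (x - y) (r x - r y) := by
      rw [← real_inner_self_eq_norm_sq]
      simp only [inner_sub_left, inner_sub_right] at h1 h2 ⊢
      linarith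
    by_contra! hlt
    nlinarith [norm_nonneg (x - y)]
  · refine ⟨subset_closure (hrK x), fun hint => hx ?_⟩
    suffices h : r x = x by rwa [h] at hint
    have hlim : Filter.Tendsto (fun t : ℝ => r x + t • (x - r x)) (nhdsWithin 0 (Set.Ioi 0))
        (nhds (r x)) := by
      have : Continuous fun t : ℝ => r x + t • (x - r x) := by fun_prop
      simpa using (this.tendsto 0).mono_left nhdsWithin_le_nhds
    obtain ⟨t, htK, ht⟩ :=
      ((hlim.eventually (mem_interior_iff_mem_nhds.1 hint)).and self_mem_nhdsWithin).exists
    have ht0 : 0 < t := ht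
    have h := hvar x _ htK
    rw [add_sub_cancel_left, inner_smul_right, real_inner_self_eq_norm_sq] at h
    have h5 : ‖x - r x‖ ^ 2 ≤ 0 := nonpos_of_mul_nonpos_right h ht0
    have : ‖x - r x‖ = 0 := by nlinarith [norm_nonneg (x - r x)]
    exact (sub_eq_zero.1 (norm_eq_zero.1 this)).symm

theorem LipschitzOnWith.eVariationOn_Icc_le {V : Type*} [PseudoEMetricSpace V] {f : ℝ → V}
    {C : NNReal} {a b : ℝ} (hf : LipschitzOnWith C f (Set.Icc a b)) :
    eVariationOn f (Set.Icc a b) ≤ C * ENNReal.ofReal (b - a) := by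
  have h := hf.comp_eVariationOn_le (g := id) (s := Set.Icc a b) (Set.mapsTo_id _)
  have h2 := (monotone_id.monotoneOn (Set.univ : Set ℝ)).eVariationOn_eq (a := a) (b := b)
    trivial trivial
  rw [Set.univ_inter] at h2
  rw [h2] at h
  exact h

theorem eVariationOn_comp_segment_le {V : Type*} [NormedAddCommGroup V] [NormedSpace ℝ V]
    {r : V → V} (hr : LipschitzWith 1 r) (f : ℝ → V) (a : ℝ) (x y : V)
    (hf : ∀ t ∈ Set.Icc a (a + 1), f t = AffineMap.lineMap x y (t - a)) :
    eVariationOn (r ∘ f) (Set.Icc a (a + 1)) ≤ ENNReal.ofReal ‖y - x‖ := by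
  have hL : LipschitzOnWith ‖y - x‖₊ f (Set.Icc a (a + 1)) :=
    LipschitzOnWith.of_dist_le_mul fun s hs t ht => by
      rw [hf s hs, hf t ht, dist_lineMap_lineMap, dist_sub_right, mul_comm, dist_comm x y,
        dist_eq_norm y x, coe_nnnorm]
  have h := (hr.comp_lipschitzOnWith hL).eVariationOn_Icc_le
  rw [add_sub_cancel_left, ENNReal.ofReal_one, mul_one, one_mul] at h
  rwa [ofReal_norm]

/-- A broken line with three sides that stays outside the interior of a convex set can be replaced
by a path in the boundary that is not longer. -/
theorem exists_path_frontier_of_broken_line {V : Type*} [NormedAddCommGroup V]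
    [InnerProductSpace ℝ V] {K : Set V} (hne : K.Nonempty) (hcomp : IsComplete K)
    (hconv : Convex ℝ K) {p A B q : V} (hp : p ∈ K) (hq : q ∈ K)
    (h₁ : ∀ x ∈ segment ℝ p A, x ∉ interior K) (h₂ : ∀ x ∈ segment ℝ A B, x ∉ interior K)
    (h₃ : ∀ x ∈ segment ℝ B q, x ∉ interior K) :
    ∃ c : ℝ → V, Continuous c ∧ c 0 = p ∧ c 3 = q ∧ (∀ t ∈ Set.Icc (0 : ℝ) 3, c t ∈ frontier K) ∧
      eVariationOn c (Set.Icc 0 3) ≤ ENNReal.ofReal (‖A - p‖ + ‖B - A‖ + ‖q - B‖) := by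
  obtain ⟨r, hr, hfix, hfr⟩ := exists_nonexpansive_retraction hne hcomp hconv
  set f : ℝ → V := fun t => p + (max 0 (min 1 t)) • (A - p) + (max 0 (min 1 (t - 1))) • (B - A)
    + (max 0 (min 1 (t - 2))) • (q - B) with hf
  have e₁ : ∀ t ∈ Set.Icc (0 : ℝ) (0 + 1), f t = AffineMap.lineMap p A (t - 0) := by
    rintro t ⟨ht0, ht1⟩
    simp only [hf]
    rw [min_eq_right (by linarith), max_eq_right ht0, min_eq_right (by linarith),
      max_eq_left (by linarith), min_eq_right (by linarith), max_eq_left (by linarith),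
      AffineMap.lineMap_apply_module]
    module
  have e₂ : ∀ t ∈ Set.Icc (1 : ℝ) (1 + 1), f t = AffineMap.lineMap A B (t - 1) := by
    rintro t ⟨ht0, ht1⟩
    simp only [hf]
    rw [min_eq_left (by linarith), max_eq_right (by norm_num), min_eq_right (by linarith),
      max_eq_right (by linarith), min_eq_right (by linarith), max_eq_left (by linarith),
      AffineMap.lineMap_apply_module]
    module
  have e₃ : ∀ t ∈ Set.Icc (2 : ℝ) (2 + 1), f t = AffineMap.lineMap B q (t - 2) := by
    rintro t ⟨ht0, ht1⟩
    simp only [hf]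
    rw [min_eq_left (by linarith), max_eq_right (by norm_num), min_eq_left (by linarith),
      max_eq_right (by norm_num), min_eq_right (by linarith), max_eq_right (by linarith),
      AffineMap.lineMap_apply_module]
    module
  have hseg : ∀ {x y : V} {s : ℝ}, 0 ≤ s → s ≤ 1 → AffineMap.lineMap x y s ∈ segment ℝ x y :=
    fun h0 h1 => by
      rw [segment_eq_image_lineMap]
      exact Set.mem_image_of_mem _ ⟨h0, h1⟩
  refine ⟨r ∘ f, hr.continuous.comp (by fun_prop), ?_, ?_, fun t ht => hfr _ ?_, ?_⟩
  · rw [Function.comp_apply, e₁ 0 (by norm_num), sub_zero, AffineMap.lineMap_apply_zero, hfix p hp]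
  · rw [Function.comp_apply, e₃ 3 (by norm_num)]
    norm_num [hfix q hq]
  · rcases le_total t 1 with h1 | h1
    · rw [e₁ t ⟨ht.1, by linarith⟩]
      exact h₁ _ (hseg (by linarith [ht.1]) (by linarith))
    rcases le_total t 2 with h2 | h2
    · rw [e₂ t ⟨h1, by linarith⟩]
      exact h₂ _ (hseg (by linarith) (by linarith))
    · rw [e₃ t ⟨h2, by linarith [ht.2]⟩]
      exact h₃ _ (hseg (by linarith) (by linarith [ht.2]))
  · have v₁ := eVariationOn_comp_segment_le hr f 0 p A e₁
    have v₂ := eVariationOn_comp_segment_le hr f 1 A B e₂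
    have v₃ := eVariationOn_comp_segment_le hr f 2 B q e₃
    have s₁ := eVariationOn.Icc_add_Icc (r ∘ f) (s := Set.univ) (a := (0 : ℝ)) (b := 1) (c := 2)
      (by norm_num) (by norm_num) trivial
    have s₂ := eVariationOn.Icc_add_Icc (r ∘ f) (s := Set.univ) (a := (0 : ℝ)) (b := 2) (c := 3)
      (by norm_num) (by norm_num) trivial
    simp only [Set.univ_inter] at s₁ s₂
    norm_num at v₁ v₂ v₃
    rw [← s₂, ← s₁, ENNReal.ofReal_add (by positivity) (by positivity),
      ENNReal.ofReal_add (by positivity) (by positivity)]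
    simp only [ofReal_norm]
    gcongr

theorem norm_sub_smul_le {V : Type*} [NormedAddCommGroup V] [InnerProductSpace ℝ V] {x : V}
    (hx : x ≠ 0) (a : V) (s : ℝ) :
    ‖x - s • a‖ ≤ ‖x‖ - s * inner ℝ (‖x‖⁻¹ • x) a + s ^ 2 * (‖a‖ ^ 2 / (2 * ‖x‖)) := by
  have hx0 : 0 < ‖x‖ := norm_pos_iff.2 hx
  have h : ‖x - s • a‖ ^ 2 = ‖x‖ ^ 2 - 2 * (s * inner ℝ x a) + s ^ 2 * ‖a‖ ^ 2 := by
    rw [norm_sub_sq_real, inner_smul_right, norm_smul, mul_pow, Real.norm_eq_abs, sq_abs]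
  have h2 : ‖x‖ - s * inner ℝ (‖x‖⁻¹ • x) a + s ^ 2 * (‖a‖ ^ 2 / (2 * ‖x‖))
      = (‖x‖ ^ 2 + ‖x - s • a‖ ^ 2) / (2 * ‖x‖) := by
    rw [h, inner_smul_left]
    simp only [conj_trivial]
    field_simp
    ring
  rw [h2, le_div_iff₀ (by positivity)]
  nlinarith [sq_nonneg (‖x‖ - ‖x - s • a‖)]

/-- First variation: moving the corner of a broken line decreases its length. -/
theorem exists_shorter_broken_line {V : Type*} [NormedAddCommGroup V] [InnerProductSpace ℝ V]
    {x y a b : V} (hx : x ≠ 0) (hy : y ≠ 0)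
    (h : ‖b - a‖ < inner ℝ (‖x‖⁻¹ • x) a + inner ℝ (‖y‖⁻¹ • y) b) :
    ∃ s : ℝ, 0 < s ∧ ‖x - s • a‖ + s * ‖b - a‖ + ‖y - s • b‖ < ‖x‖ + ‖y‖ := by
  set κ := inner ℝ (‖x‖⁻¹ • x) a + inner ℝ (‖y‖⁻¹ • y) b - ‖b - a‖ with hκ
  set M := ‖a‖ ^ 2 / (2 * ‖x‖) + ‖b‖ ^ 2 / (2 * ‖y‖) with hM
  have hκ0 : 0 < κ := by linarith
  have hM0 : 0 ≤ M := by positivity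
  refine ⟨κ / (M + 1), by positivity, ?_⟩
  set s := κ / (M + 1) with hs
  have hs0 : 0 < s := by positivity
  have hsκ : s * (M + 1) = κ := by rw [hs]; field_simp
  have h1 := norm_sub_smul_le hx a s
  have h2 := norm_sub_smul_le hy b s
  have h3 : s * (s * M - κ) < 0 := mul_neg_of_pos_of_neg hs0 (by nlinarith)
  rw [hκ] at h3
  rw [hM] at h3
  nlinarith

section ExtremePoints

variable {V : Type*} [NormedAddCommGroup V] [InnerProductSpace ℝ V] {S : Set V} {v : V}

theorem notMem_convexHull_sdiff_of_mem_extremePoints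
    (hv : v ∈ Set.extremePoints ℝ (convexHull ℝ S)) : v ∉ convexHull ℝ (S \ {v}) := by
  have h := ((convex_convexHull ℝ S).mem_extremePoints_iff_convex_sdiff.1 hv).2
  exact fun hmem => (convexHull_min (Set.sdiff_subset_sdiff_left (subset_convexHull ℝ S)) h hmem).2 rfl

theorem exists_mem_segment_of_mem_convexHull {x : V} (hx : x ∈ convexHull ℝ S) (hxv : x ≠ v) :
    ∃ y ∈ convexHull ℝ (S \ {v}), x ∈ segment ℝ v y := by
  have hx' : x ∈ convexHull ℝ (insert v (S \ {v})) :=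
    convexHull_mono (by rw [Set.insert_sdiff_singleton]; exact Set.subset_insert v S) hx
  rcases (S \ {v}).eq_empty_or_nonempty with h | h
  · rw [h] at hx'
    simp [hxv] at hx'
  · rw [convexHull_insert h, mem_convexJoin] at hx'
    obtain ⟨a, rfl, y, hy, hxy⟩ := hx'
    exact ⟨y, hy, hxy⟩

/-- Near an extreme point `v` of a polytope, every face contains `v`. -/
theorem exists_pos_forall_face_contains_extremePoint (hS : S.Finite)
    (hv : v ∈ Set.extremePoints ℝ (convexHull ℝ S)) :
    ∃ δ > (0 : ℝ), ∀ p ∈ convexHull ℝ S, dist p v < δ → ∀ f : V →L[ℝ] ℝ,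
      (∀ x ∈ convexHull ℝ S, f x ≤ f p) → f v = f p := by
  have hclosed : IsClosed (convexHull ℝ (S \ {v})) :=
    (hS.sdiff.isCompact_convexHull ℝ).isClosed
  obtain ⟨δ, hδ, hball⟩ := Metric.isOpen_iff.1 hclosed.isOpen_compl v
    (notMem_convexHull_sdiff_of_mem_extremePoints hv)
  refine ⟨δ, hδ, fun p hp hpv f hf => ?_⟩
  by_cases hne : p = v
  · rw [hne]
  obtain ⟨y, hy, a, b, ha, hb, hab, rfl⟩ := exists_mem_segment_of_mem_convexHull hp hne
  refine le_antisymm (hf v hv.1) (not_lt.1 fun hlt => ?_)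
  have hfy := hf y (convexHull_mono Set.sdiff_subset hy)
  simp only [map_add, map_smul, smul_eq_mul] at hlt hfy
  have ha0 : a = 0 := by
    by_contra hne
    have : 0 < a := lt_of_le_of_ne ha (Ne.symm hne)
    obtain rfl : b = 1 - a := by linarith
    nlinarith
  obtain rfl : b = 1 := by linarith
  subst ha0
  simp only [zero_smul, one_smul, zero_add] at hpv
  exact hball hpv hy

/-- An extreme point of a polytope is exposed by a functional not vanishing at a given vector. -/
theorem exists_exposing_functional_ne_zero (hS : S.Finite)
    (hv : v ∈ Set.extremePoints ℝ (convexHull ℝ S)) {u : V} (hu : u ≠ 0) :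
    ∃ m : V →L[ℝ] ℝ, m u ≠ 0 ∧ ∀ x ∈ convexHull ℝ S, x ≠ v → m x < m v := by
  have hcpt : IsCompact (convexHull ℝ (S \ {v})) := hS.sdiff.isCompact_convexHull ℝ
  suffices h : ∃ m : V →L[ℝ] ℝ, m u ≠ 0 ∧ ∀ y ∈ convexHull ℝ (S \ {v}), m y < m v by
    obtain ⟨m, hmu, hm⟩ := h
    refine ⟨m, hmu, fun x hx hxv => ?_⟩
    obtain ⟨y, hy, a, b, ha, hb, hab, rfl⟩ := exists_mem_segment_of_mem_convexHull hx hxv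
    have hb0 : 0 < b := by
      refine lt_of_le_of_ne hb fun h0 => hxv ?_
      subst h0
      obtain rfl : a = 1 := by linarith
      simp
    obtain rfl : a = 1 - b := by linarith
    simp only [map_add, map_smul, smul_eq_mul]
    nlinarith [hm y hy]
  obtain ⟨m, c, hm, hc⟩ := geometric_hahn_banach_closed_point (convex_convexHull ℝ _)
    hcpt.isClosed (notMem_convexHull_sdiff_of_mem_extremePoints hv)
  by_cases hmu : m u = 0
  swap
  · exact ⟨m, hmu, fun y hy => (hm y hy).trans hc⟩
  obtain ⟨R, hR⟩ := hcpt.exists_bound_of_continuousOn (f := fun y => innerSL ℝ u (y - v))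
    (by fun_prop)
  set ε := (m v - c) / (|R| + 1) with hε
  have hε0 : 0 < ε := div_pos (sub_pos.2 hc) (by positivity)
  have hεR : ε * (|R| + 1) = m v - c := by rw [hε]; field_simp
  refine ⟨m + ε • innerSL ℝ u, ?_, fun y hy => ?_⟩
  · have : 0 < ‖u‖ := norm_pos_iff.2 hu
    simp only [add_apply, smul_apply, hmu, zero_add,
      smul_eq_mul, innerSL_apply_apply, real_inner_self_eq_norm_sq]
    positivity
  · have h1 : innerSL ℝ u y - innerSL ℝ u v ≤ |R| := by
      rw [← map_sub]
      exact (le_abs_self _).trans ((hR y hy).trans (le_abs_self R))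
    have h2 := hm y hy
    simp only [add_apply, smul_apply, smul_eq_mul]
    nlinarith

end ExtremePoints

theorem exists_supporting_functional {V : Type*} [NormedAddCommGroup V] [NormedSpace ℝ V]
    {K : Set V} (hconv : Convex ℝ K) (hint : (interior K).Nonempty) {p : V}
    (hp : p ∈ frontier K) :
    ∃ f : V →L[ℝ] ℝ, (∀ x ∈ interior K, f x < f p) ∧ ∀ x ∈ K, f x ≤ f p := by
  obtain ⟨f, hf⟩ := geometric_hahn_banach_open_point hconv.interior isOpen_interior hp.2
  refine ⟨f, hf, fun x hx => ?_⟩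
  have hx' : x ∈ closure (interior K) := by
    rw [hconv.closure_interior_eq_closure_of_nonempty_interior hint]
    exact subset_closure hx
  exact closure_minimal (fun y hy => (hf y hy).le) (isClosed_le f.continuous continuous_const) hx'

theorem exists_ne_zero_map_eq_zero_of_two_lt_finrank {V : Type*} [NormedAddCommGroup V]
    [NormedSpace ℝ V] [FiniteDimensional ℝ V] (hdim : 2 < Module.finrank ℝ V)
    (f g : V →L[ℝ] ℝ) : ∃ u : V, u ≠ 0 ∧ f u = 0 ∧ g u = 0 := by
  have h := LinearMap.ker_ne_bot_of_finrank_lt (f := (f : V →ₗ[ℝ] ℝ).prod (g : V →ₗ[ℝ] ℝ))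
    (by simpa using hdim)
  obtain ⟨u, hu, hu0⟩ := (Submodule.ne_bot_iff _).1 h
  rw [LinearMap.mem_ker] at hu
  exact ⟨u, hu0, congrArg Prod.fst hu, congrArg Prod.snd hu⟩

theorem notMem_interior_of_mem_segment {V : Type*} [NormedAddCommGroup V] [NormedSpace ℝ V]
    {K : Set V} {f : V →L[ℝ] ℝ} {c : ℝ} (hf : ∀ x ∈ interior K, f x < c) {x y : V}
    (hx : c ≤ f x) (hy : c ≤ f y) : ∀ z ∈ segment ℝ x y, z ∉ interior K := fun z hz hzi =>
  (hf z hzi).not_ge ((convex_halfSpace_ge f.toLinearMap.isLinear c).segment_subset hx hy hz)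

theorem norm_sub_lt_two_of_ne_neg {V : Type*} [NormedAddCommGroup V] [InnerProductSpace ℝ V]
    {x y : V} (hx : ‖x‖ = 1) (hy : ‖y‖ = 1) (h : x + y ≠ 0) : ‖y - x‖ < 2 := by
  have h1 := parallelogram_law_with_norm ℝ y x
  have h2 : 0 < ‖y + x‖ := norm_pos_iff.2 (by rwa [add_comm])
  rw [hx, hy] at h1
  nlinarith [norm_nonneg (y - x)]

/-- On the boundary of a polytope of dimension at least three, the broken line through a vertex is
never a shortest path between two points near that vertex. -/
theorem exists_shortcut_near_extremePoint {V : Type*} [NormedAddCommGroup V]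
    [InnerProductSpace ℝ V] [FiniteDimensional ℝ V] (hdim : 2 < Module.finrank ℝ V) {S : Set V}
    (hS : S.Finite) (hint : (interior (convexHull ℝ S)).Nonempty) {v : V}
    (hv : v ∈ Set.extremePoints ℝ (convexHull ℝ S)) (hvi : v ∉ interior (convexHull ℝ S)) :
    ∃ δ > (0 : ℝ), ∀ p ∈ frontier (convexHull ℝ S), ∀ q ∈ frontier (convexHull ℝ S),
      dist p v < δ → dist q v < δ → p ≠ v → q ≠ v →
      ∃ c : ℝ → V, Continuous c ∧ c 0 = p ∧ c 3 = q ∧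
        (∀ t ∈ Set.Icc (0 : ℝ) 3, c t ∈ frontier (convexHull ℝ S)) ∧
        eVariationOn c (Set.Icc 0 3) < ENNReal.ofReal (‖p - v‖ + ‖q - v‖) := by
  obtain ⟨δ, hδ, hface⟩ := exists_pos_forall_face_contains_extremePoint hS hv
  refine ⟨δ, hδ, fun p hp q hq hpδ hqδ hpv hqv => ?_⟩
  set K := convexHull ℝ S with hK
  have hconv : Convex ℝ K := convex_convexHull ℝ S
  have hcpt : IsCompact K := hS.isCompact_convexHull ℝ
  have hpK : p ∈ K := hcpt.isClosed.frontier_subset hp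
  have hqK : q ∈ K := hcpt.isClosed.frontier_subset hq
  obtain ⟨f, hfi, hf⟩ := exists_supporting_functional hconv hint hp
  obtain ⟨g, hgi, hg⟩ := exists_supporting_functional hconv hint hq
  have hfv := hface p hpK hpδ f hf
  have hgv := hface q hqK hqδ g hg
  have hx : p - v ≠ 0 := sub_ne_zero.2 hpv
  have hy : q - v ≠ 0 := sub_ne_zero.2 hqv
  have hx0 : 0 < ‖p - v‖ := norm_pos_iff.2 hx
  have hy0 : 0 < ‖q - v‖ := norm_pos_iff.2 hy
  set x := ‖p - v‖⁻¹ • (p - v) with hxdef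
  set y := ‖q - v‖⁻¹ • (q - v) with hydef
  have hfx : f x = 0 := by simp [hxdef, hfv]
  have hgy : g y = 0 := by simp [hydef, hgv]
  have key : ∀ a b : V, ∀ m : V →L[ℝ] ℝ, f a = 0 → g b = 0 → 0 ≤ m a → 0 ≤ m b →
      (∀ z ∈ interior K, m z < m v) → ‖b - a‖ < inner ℝ x a + inner ℝ y b →
      ∃ c : ℝ → V, Continuous c ∧ c 0 = p ∧ c 3 = q ∧
        (∀ t ∈ Set.Icc (0 : ℝ) 3, c t ∈ frontier K) ∧
        eVariationOn c (Set.Icc 0 3) < ENNReal.ofReal (‖p - v‖ + ‖q - v‖) := by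
    intro a b m hfa hgb hma hmb hm hab
    obtain ⟨s, hs, hlen⟩ := exists_shorter_broken_line hx hy hab
    obtain ⟨c, hc, hc0, hc3, hcK, hcl⟩ := exists_path_frontier_of_broken_line ⟨p, hpK⟩
      hcpt.isComplete hconv hpK hqK (A := v + s • a) (B := v + s • b)
      (notMem_interior_of_mem_segment hfi le_rfl (by simp [hfa, hfv]))
      (notMem_interior_of_mem_segment hm (by simp; positivity) (by simp; positivity))
      (notMem_interior_of_mem_segment hgi (by simp [hgb, hgv]) le_rfl)
    refine ⟨c, hc, hc0, hc3, hcK, hcl.trans_lt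
      ((ENNReal.ofReal_lt_ofReal_iff (by positivity)).2 ?_)⟩
    have e₁ : v + s • a - p = -((p - v) - s • a) := by abel
    have e₂ : v + s • b - (v + s • a) = s • (b - a) := by rw [smul_sub]; abel
    have e₃ : q - (v + s • b) = (q - v) - s • b := by abel
    rwa [e₁, e₂, e₃, norm_neg, norm_smul, Real.norm_of_nonneg hs.le]
  obtain ⟨u, hu, hfu, hgu⟩ := exists_ne_zero_map_eq_zero_of_two_lt_finrank hdim f g
  rcases lt_trichotomy (inner ℝ x u + inner ℝ y u) 0 with h | h | h
  · refine key (-u) (-u) f (by simp [hfu]) (by simp [hgu]) (by simp [hfu]) (by simp [hfu])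
      (by rwa [hfv]) ?_
    rw [sub_self, norm_zero, inner_neg_right, inner_neg_right]
    linarith
  · obtain ⟨m, hmu, hm⟩ := exists_exposing_functional_ne_zero hS hv hu
    have hmi : ∀ z ∈ interior K, m z < m v := fun z hz =>
      hm z (interior_subset hz) fun hzv => hvi (hzv ▸ hz)
    have hmx : m x < 0 := by
      rw [hxdef, map_smul, map_sub, smul_eq_mul]
      exact mul_neg_of_pos_of_neg (by positivity) (sub_neg.2 (hm p hpK hpv))
    have hmy : m y < 0 := by
      rw [hydef, map_smul, map_sub, smul_eq_mul]
      exact mul_neg_of_pos_of_neg (by positivity) (sub_neg.2 (hm q hqK hqv))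
    have hx1 : ‖x‖ = 1 := norm_smul_inv_norm (𝕜 := ℝ) hx
    have hy1 : ‖y‖ = 1 := norm_smul_inv_norm (𝕜 := ℝ) hy
    clear_value x y
    have hxy : ‖y - x‖ < 2 := norm_sub_lt_two_of_ne_neg hx1 hy1 fun h0 => by
      have h1 := congrArg m h0
      rw [map_add, map_zero] at h1
      linarith
    set μ := (-m x - m y) / m u with hμ
    have hμu : μ * m u = -m x - m y := by rw [hμ]; field_simp
    refine key (x + μ • u) (y + μ • u) m (by simp [hfx, hfu]) (by simp [hgy, hgu]) ?_ ?_ hmi ?_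
    · rw [map_add, map_smul, smul_eq_mul, hμu]
      linarith
    · rw [map_add, map_smul, smul_eq_mul, hμu]
      linarith
    · rw [add_sub_add_right_eq_sub, inner_add_right, inner_add_right, inner_smul_right,
        inner_smul_right, real_inner_self_eq_norm_sq, real_inner_self_eq_norm_sq, hx1, hy1]
      linear_combination hxy - μ * h
  · refine key u u f hfu hgu hfu.ge hfu.ge (by rwa [hfv]) ?_
    rwa [sub_self, norm_zero]

theorem Function.Periodic.ne_of_injOn_Ico {α : Type*} {γ : ℝ → α} (hper : Function.Periodic γ 1)
    (hinj : Set.InjOn γ (Set.Ico (0 : ℝ) 1)) {s t : ℝ} (hst : s ≠ t) (hlt : |s - t| < 1) :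
    γ s ≠ γ t := by
  intro h
  have hfr : ∀ x, γ (Int.fract x) = γ x := fun x => by
    have h1 := hper.sub_int_mul_eq (x := x) ⌊x⌋
    rwa [mul_one, Int.self_sub_floor] at h1
  have hmem : ∀ x : ℝ, Int.fract x ∈ Set.Ico (0 : ℝ) 1 := fun x =>
    ⟨Int.fract_nonneg x, Int.fract_lt_one x⟩
  have h2 : Int.fract s = Int.fract t := hinj (hmem s) (hmem t) (by rw [hfr, hfr, h])
  obtain ⟨z, hz⟩ := Int.fract_eq_fract.1 h2
  rw [hz] at hlt
  have hz0 : z = 0 := Int.abs_lt_one_iff.1 (by exact_mod_cast hlt)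
  rw [hz0, Int.cast_zero] at hz
  exact hst (sub_eq_zero.1 hz)

/-- A simple closed geodesic on the surface of a convex polytope in `ℝ³`
passes through no vertex (extreme point) of the polytope. -/
theorem geodesic_avoids_vertices
    (S K : Set (EuclideanSpace ℝ (Fin 3))) (hS : S.Finite)
    (hK : K = convexHull ℝ S) (hint : (interior K).Nonempty)
    (γ : ℝ → EuclideanSpace ℝ (Fin 3))
    (hγ : IsSimpleClosedGeodesicIn (frontier K) γ) :
    Set.range γ ∩ Set.extremePoints ℝ K = ∅ := by
  subst hK
  obtain ⟨hcont, hper, hinj, hmem, -, -, hgeo⟩ := hγ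
  refine Set.eq_empty_iff_forall_notMem.2 ?_
  rintro _ ⟨⟨t, rfl⟩, hv⟩
  obtain ⟨δ, hδ, hcut⟩ := exists_shortcut_near_extremePoint (by simp) hS hint hv (hmem t).2
  obtain ⟨ε, hε, hmin⟩ := hgeo t
  obtain ⟨η, hη, hclose⟩ := Metric.continuous_iff.1 hcont t δ hδ
  obtain ⟨ρ, hρ0, hρ⟩ := exists_between (lt_min hε (lt_min hη (one_pos (α := ℝ))))
  rw [lt_min_iff, lt_min_iff] at hρ
  obtain ⟨hρε, hρη, hρ1⟩ := hρ
  have hl : |t - ρ - t| = ρ := by rw [sub_sub_cancel_left, abs_neg, abs_of_pos hρ0]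
  have hr : |t + ρ - t| = ρ := by rw [add_sub_cancel_left, abs_of_pos hρ0]
  obtain ⟨c, hc, hc0, hc3, hcK, hlen⟩ := hcut (γ (t - ρ)) (hmem _) (γ (t + ρ)) (hmem _)
    (hclose _ (by rwa [Real.dist_eq, hl])) (hclose _ (by rwa [Real.dist_eq, hr]))
    (hper.ne_of_injOn_Ico hinj (by linarith) (by rwa [hl]))
    (hper.ne_of_injOn_Ico hinj (by linarith) (by rwa [hr]))
  have hle := hmin (t - ρ) (t + ρ) ⟨by linarith, by linarith⟩ ⟨by linarith, by linarith⟩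
    (by linarith) 0 3 c (by norm_num) hc.continuousOn hc0 hc3 hcK
  refine (hle.trans_lt hlen).not_ge ?_
  have hadd := eVariationOn.Icc_add_Icc γ (s := Set.univ) (a := t - ρ) (b := t) (c := t + ρ)
    (by linarith) (by linarith) trivial
  simp only [Set.univ_inter] at hadd
  rw [← hadd, ENNReal.ofReal_add (norm_nonneg _) (norm_nonneg _), ← dist_eq_norm, ← dist_eq_norm,
    ← edist_dist, ← edist_dist]
  exact add_le_add
    (eVariationOn.edist_le γ ⟨le_rfl, by linarith⟩ ⟨by linarith, le_rfl⟩)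
    (eVariationOn.edist_le γ ⟨by linarith, le_rfl⟩ ⟨le_rfl, by linarith⟩)
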